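/- For every nilpotent A ∈ C_B there exists an invertible matrix G ∈ C_B (i.e. G commutes with J) such that (G^{-1}AG)(i) is lower triangular for every i = 1,...,u. -/

import Mathlib

open Matrix

/-- The nilpotent Jordan matrix which, for each `k : Fin u`, has `c k` Jordan blocks of
size `ν k`, realized on the index type `Σ k : Fin u, Fin (c k) × Fin (ν k)`. -/
def jordanMatrixM (K : Type*) [Field K] (u : ℕ) (c ν : Fin u → ℕ) :
    Matrix (Σ k : Fin u, Fin (c k) × Fin (ν k)) (Σ k : Fin u, Fin (c k) × Fin (ν k)) K :=
  fun p q =>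
    if p.1 = q.1 ∧ (p.2.1 : ℕ) = (q.2.1 : ℕ) ∧ (p.2.2 : ℕ) + 1 = (q.2.2 : ℕ) then 1 else 0

/-- For `A` commuting with `J` and a group `i` of Jordan blocks of equal size `ν i`,
`A(i)` is the `(c i) × (c i)` matrix of the constant diagonal values (the `(1,1)` entries)
of the Toeplitz blocks of `A` joining two Jordan blocks of size `ν i`. -/
def diagPart {K : Type*} [Field K] {u : ℕ} {c ν : Fin u → ℕ} (hν : ∀ k, 0 < ν k)
    (A : Matrix (Σ k : Fin u, Fin (c k) × Fin (ν k))
      (Σ k : Fin u, Fin (c k) × Fin (ν k)) K)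
    (i : Fin u) : Matrix (Fin (c i)) (Fin (c i)) K :=
  fun j k => A ⟨i, (j, ⟨0, hν i⟩)⟩ ⟨i, (k, ⟨0, hν i⟩)⟩

open scoped Kronecker

/-- A nilpotent endomorphism of a finite-dimensional vector space is lower triangular in a
suitable basis. -/
theorem IsNilpotent.exists_basis_lower_triangular {K : Type*} [Field K] (n : ℕ) :
    ∀ {V : Type*} [AddCommGroup V] [Module K V] [FiniteDimensional K V]
      (f : Module.End K V), IsNilpotent f → Module.finrank K V = n →
      ∃ b : Module.Basis (Fin n) K V, ∀ j k, j < k → b.repr (f (b k)) j = 0 := by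
  induction n with
  | zero =>
    intro V _ _ _ f _ hn
    exact ⟨Module.finBasisOfFinrankEq K V hn, fun j => j.elim0⟩
  | succ n ih =>
    intro V _ _ _ f hf hn
    have : Nontrivial V := Module.nontrivial_of_finrank_pos (R := K) (by omega)
    have hrange : LinearMap.range f < ⊤ := by
      rw [lt_top_iff_ne_top]
      intro h
      exact hf.not_isUnit ((LinearMap.isUnit_iff_range_eq_top f).2 h)
    obtain ⟨φ, hφ, hle⟩ := Submodule.exists_le_ker_of_lt_top _ hrange
    obtain ⟨v, hv⟩ : ∃ v, φ v ≠ 0 := by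
      by_contra! h
      exact hφ (LinearMap.ext h)
    have hmem (x : V) : f x ∈ LinearMap.ker φ := hle ⟨x, rfl⟩
    have hfin : Module.finrank K (LinearMap.ker φ) = n := by
      have := Module.Dual.finrank_ker_add_one_of_ne_zero hφ
      omega
    obtain ⟨b', hb'⟩ := ih (f.restrict (p := LinearMap.ker φ) fun x _ => hmem x)
      (Module.End.isNilpotent.restrict (fun x _ => hmem x) hf) hfin
    have hli (a : K) (x : V) (hx : x ∈ LinearMap.ker φ) (h : a • v + x = 0) : a = 0 := by
      have h' := congrArg φ h
      rw [LinearMap.mem_ker] at hx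
      simpa [hx, hv] using h'
    have hsp (z : V) : ∃ a : K, z + a • v ∈ LinearMap.ker φ :=
      ⟨-(φ z / φ v), by simp [hv]⟩
    let b := Module.Basis.mkFinCons v b' hli hsp
    have hbs (i : Fin n) : b i.succ = b' i := by simp [b]
    have hrepr (w : LinearMap.ker φ) (j : Fin (n + 1)) :
        b.repr w j = Fin.cases 0 (fun i => b'.repr w i) j := by
      have hw : (w : V) = ∑ i, b'.repr w i • b i.succ := by
        simp_rw [hbs]
        exact_mod_cast congrArg Subtype.val (b'.sum_repr w).symm
      rw [hw]
      simp only [map_sum, map_smul, Module.Basis.repr_self, Finsupp.coe_finsetSum,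
        Finsupp.coe_smul, Finset.sum_apply, Pi.smul_apply, smul_eq_mul]
      cases j using Fin.cases with
      | zero => simp
      | succ j => simp [Finsupp.single_apply]
    refine ⟨b, fun j k hjk => ?_⟩
    cases k using Fin.cases with
    | zero => exact absurd hjk (Fin.not_lt_zero j)
    | succ k =>
      rw [hbs, ← LinearMap.coe_restrict_apply (p := LinearMap.ker φ) (q := LinearMap.ker φ)
        (hf := fun x _ => hmem x), hrepr]
      cases j using Fin.cases with
      | zero => rfl
      | succ j => exact hb' j k (Fin.succ_lt_succ_iff.1 hjk)

/-- A nilpotent matrix over a field is conjugate to a lower triangular matrix. -/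
theorem Matrix.exists_conj_lower_triangular_of_isNilpotent {K : Type*} [Field K] {n : ℕ}
    (N : Matrix (Fin n) (Fin n) K) (hN : IsNilpotent N) :
    ∃ P Q : Matrix (Fin n) (Fin n) K, P * Q = 1 ∧ Q * P = 1 ∧
      ∀ j k, j < k → (Q * N * P) j k = 0 := by
  obtain ⟨b, hb⟩ := IsNilpotent.exists_basis_lower_triangular n (Matrix.toLin' N)
    (hN.map (Matrix.toLinAlgEquiv' : Matrix (Fin n) (Fin n) K ≃ₐ[K] _)) (by simp)
  let e := Pi.basisFun K (Fin n)
  refine ⟨e.toMatrix b, b.toMatrix e, Module.Basis.toMatrix_mul_toMatrix_flip _ _,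
    Module.Basis.toMatrix_mul_toMatrix_flip _ _, fun j k hjk => ?_⟩
  have hNe : LinearMap.toMatrix e e (Matrix.toLin' N) = N := by
    rw [← Matrix.toLin_eq_toLin', LinearMap.toMatrix_toLin]
  rw [← hNe, basis_toMatrix_mul_linearMap_toMatrix_mul_basis_toMatrix,
    LinearMap.toMatrix_apply]
  exact hb j k hjk

section Centralizer

variable {K : Type*} [Field K] {u : ℕ} {c ν : Fin u → ℕ}

local notation "Idx" => (Σ k : Fin u, Fin (c k) × Fin (ν k))

theorem mul_jordanMatrixM_apply_zero (A : Matrix Idx Idx K) (p : Idx) (b : Fin u)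
    (k : Fin (c b)) (h : 0 < ν b) :
    (A * jordanMatrixM K u c ν) p ⟨b, (k, ⟨0, h⟩)⟩ = 0 := by
  simp [Matrix.mul_apply, jordanMatrixM]

theorem mul_jordanMatrixM_apply_succ (A : Matrix Idx Idx K) (p : Idx) (b : Fin u)
    (k : Fin (c b)) (t : ℕ) (h : t + 1 < ν b) :
    (A * jordanMatrixM K u c ν) p ⟨b, (k, ⟨t + 1, h⟩)⟩ = A p ⟨b, (k, ⟨t, by omega⟩)⟩ := by
  rw [Matrix.mul_apply, Finset.sum_eq_single ⟨b, (k, ⟨t, by omega⟩)⟩]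
  · simp [jordanMatrixM]
  · rintro ⟨b', k', t'⟩ - hne
    rw [jordanMatrixM, if_neg, mul_zero]
    rintro ⟨h1, h2, h3⟩
    dsimp only at h1 h2 h3
    subst h1
    apply hne
    have h2 : k' = k := Fin.ext h2
    have h3 : t' = ⟨t, by omega⟩ := Fin.ext (by simpa using h3)
    rw [h2, h3]
  · simp

theorem jordanMatrixM_mul_apply_last (A : Matrix Idx Idx K) (q : Idx) (a : Fin u)
    (j : Fin (c a)) (s : ℕ) (h : s < ν a) (hs : s + 1 = ν a) :
    (jordanMatrixM K u c ν * A) ⟨a, (j, ⟨s, h⟩)⟩ q = 0 := by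
  rw [Matrix.mul_apply]
  refine Finset.sum_eq_zero ?_
  rintro ⟨b', k', t'⟩ -
  rw [jordanMatrixM, if_neg, zero_mul]
  rintro ⟨h1, h2, h3⟩
  dsimp only at h1 h2 h3
  subst h1
  omega

theorem jordanMatrixM_mul_apply_of_lt (A : Matrix Idx Idx K) (q : Idx) (a : Fin u)
    (j : Fin (c a)) (s : ℕ) (h : s + 1 < ν a) :
    (jordanMatrixM K u c ν * A) ⟨a, (j, ⟨s, by omega⟩)⟩ q = A ⟨a, (j, ⟨s + 1, h⟩)⟩ q := by
  rw [Matrix.mul_apply, Finset.sum_eq_single ⟨a, (j, ⟨s + 1, h⟩)⟩]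
  · simp [jordanMatrixM]
  · rintro ⟨b', k', t'⟩ - hne
    rw [jordanMatrixM, if_neg, zero_mul]
    rintro ⟨h1, h2, h3⟩
    dsimp only at h1 h2 h3
    subst h1
    apply hne
    have h2 : k' = j := Fin.ext h2.symm
    have h3 : t' = ⟨s + 1, h⟩ := Fin.ext h3.symm
    rw [h2, h3]
  · simp

/-- A matrix commuting with `J` maps the kernel of `J` to itself. -/
theorem apply_zero_eq_zero_of_commute {A : Matrix Idx Idx K}
    (hA : A * jordanMatrixM K u c ν = jordanMatrixM K u c ν * A)
    (a b : Fin u) (j : Fin (c a)) (k : Fin (c b)) (s : Fin (ν a)) (hs : (s : ℕ) ≠ 0)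
    (h : 0 < ν b) : A ⟨a, (j, s)⟩ ⟨b, (k, ⟨0, h⟩)⟩ = 0 := by
  obtain ⟨_ | s, hs'⟩ := s
  · exact absurd rfl hs
  · rw [← jordanMatrixM_mul_apply_of_lt A _ a j s hs', ← hA, mul_jordanMatrixM_apply_zero]

/-- The first column of a block from a larger to a smaller Jordan block starts with zero. -/
theorem apply_zero_zero_eq_zero_of_commute {A : Matrix Idx Idx K}
    (hA : A * jordanMatrixM K u c ν = jordanMatrixM K u c ν * A)
    (a b : Fin u) (j : Fin (c a)) (k : Fin (c b)) (hab : ν a < ν b) (h : 0 < ν a) :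
    A ⟨a, (j, ⟨0, h⟩)⟩ ⟨b, (k, ⟨0, h.trans hab⟩)⟩ = 0 := by
  have hdiag (s : ℕ) (hs : s < ν a) : A ⟨a, (j, ⟨0, h⟩)⟩ ⟨b, (k, ⟨0, h.trans hab⟩)⟩ =
      A ⟨a, (j, ⟨s, hs⟩)⟩ ⟨b, (k, ⟨s, hs.trans hab⟩)⟩ := by
    induction s with
    | zero => rfl
    | succ s ih =>
      rw [ih (by omega), ← jordanMatrixM_mul_apply_of_lt A _ a j s hs, ← hA,
        mul_jordanMatrixM_apply_succ]
  rw [hdiag (ν a - 1) (by omega), ← mul_jordanMatrixM_apply_succ A _ b k (ν a - 1) (by omega),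
    hA, jordanMatrixM_mul_apply_last _ _ _ _ _ _ (by omega)]

theorem diagPart_mul (hνanti : StrictAnti ν) (hν : ∀ k, 0 < ν k) {A B : Matrix Idx Idx K}
    (hA : A * jordanMatrixM K u c ν = jordanMatrixM K u c ν * A)
    (hB : B * jordanMatrixM K u c ν = jordanMatrixM K u c ν * B) (i : Fin u) :
    diagPart hν (A * B) i = diagPart hν A i * diagPart hν B i := by
  ext j k
  rw [diagPart, Matrix.mul_apply, Matrix.mul_apply, Fintype.sum_sigma,
    Finset.sum_eq_single i, Fintype.sum_prod_type]
  · refine Finset.sum_congr rfl fun m _ => ?_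
    rw [Finset.sum_eq_single ⟨0, hν i⟩]
    · rfl
    · intro s _ hs
      rw [apply_zero_eq_zero_of_commute hB i i m k s (fun h => hs (Fin.ext h)), mul_zero]
    · simp
  · rintro l - hl
    refine Finset.sum_eq_zero ?_
    rintro ⟨m, s⟩ -
    by_cases hs : (s : ℕ) = 0
    · obtain rfl : s = ⟨0, hν l⟩ := Fin.ext hs
      rcases lt_or_gt_of_ne (hνanti.injective.ne hl) with h | h
      · rw [apply_zero_zero_eq_zero_of_commute hB l i m k h, mul_zero]
      · rw [apply_zero_zero_eq_zero_of_commute hA i l j m h, zero_mul]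
    · rw [apply_zero_eq_zero_of_commute hB l i m k s hs, mul_zero]
  · simp

theorem diagPart_one (hν : ∀ k, 0 < ν k) (i : Fin u) :
    diagPart hν (1 : Matrix Idx Idx K) i = 1 := by
  ext j k
  simp [diagPart, Matrix.one_apply]

theorem isNilpotent_diagPart (hνanti : StrictAnti ν) (hν : ∀ k, 0 < ν k)
    {A : Matrix Idx Idx K} (hA : A * jordanMatrixM K u c ν = jordanMatrixM K u c ν * A)
    (hnil : IsNilpotent A) (i : Fin u) : IsNilpotent (diagPart hν A i) := by
  obtain ⟨n, hn⟩ := hnil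
  have hpow (m : ℕ) : diagPart hν (A ^ m) i = diagPart hν A i ^ m := by
    induction m with
    | zero => rw [pow_zero, pow_zero, diagPart_one]
    | succ m ih =>
      rw [pow_succ, pow_succ, ← ih]
      exact diagPart_mul hνanti hν (Commute.pow_left hA m) hA i
  refine ⟨n, ?_⟩
  rw [← hpow, hn]
  rfl

variable (ν) in
/-- The block diagonal matrix whose `i`-th block is `P i ⊗ 1`. -/
def scalarBlocks (P : ∀ i, Matrix (Fin (c i)) (Fin (c i)) K) : Matrix Idx Idx K :=
  Matrix.blockDiagonal' fun i => P i ⊗ₖ (1 : Matrix (Fin (ν i)) (Fin (ν i)) K)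

theorem jordanMatrixM_eq_blockDiagonal' :
    jordanMatrixM K u c ν = Matrix.blockDiagonal' fun i =>
      (1 : Matrix (Fin (c i)) (Fin (c i)) K) ⊗ₖ
        Matrix.of fun s t : Fin (ν i) => if (s : ℕ) + 1 = t then (1 : K) else 0 := by
  ext ⟨a, j, s⟩ ⟨b, k, t⟩
  by_cases h : a = b
  · subst h
    by_cases hjk : j = k <;>
      simp [jordanMatrixM, hjk, ← Fin.ext_iff]
  · simp [jordanMatrixM, Matrix.blockDiagonal'_apply_ne _ _ _ h, h]

theorem scalarBlocks_commute (P : ∀ i, Matrix (Fin (c i)) (Fin (c i)) K) :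
    scalarBlocks ν P * jordanMatrixM K u c ν = jordanMatrixM K u c ν * scalarBlocks ν P := by
  simp only [scalarBlocks, jordanMatrixM_eq_blockDiagonal', ← Matrix.blockDiagonal'_mul,
    ← Matrix.mul_kronecker_mul, Matrix.one_mul, Matrix.mul_one]

theorem scalarBlocks_mul_eq_one {P Q : ∀ i, Matrix (Fin (c i)) (Fin (c i)) K}
    (h : ∀ i, P i * Q i = 1) : (scalarBlocks ν P * scalarBlocks ν Q : Matrix Idx Idx K) = 1 := by
  simp only [scalarBlocks, ← Matrix.blockDiagonal'_mul, ← Matrix.mul_kronecker_mul,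
    Matrix.mul_one, h, Matrix.one_kronecker_one]
  exact Matrix.blockDiagonal'_one

theorem diagPart_scalarBlocks (hν : ∀ k, 0 < ν k)
    (P : ∀ i, Matrix (Fin (c i)) (Fin (c i)) K) (i : Fin u) :
    diagPart hν (scalarBlocks ν P) i = P i := by
  ext j k
  simp [diagPart, scalarBlocks, Matrix.blockDiagonal'_apply_eq]

end Centralizer

/-- For every nilpotent `A` in the centralizer of the Jordan matrix `J` of type `B` there is
an invertible `G` commuting with `J` such that `(G⁻¹ A G)(i)` is lower triangular for every
`i = 1, ..., u`. -/
theorem exists_conjugation_lower_triangular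
    (K : Type*) [Field K]
    (u : ℕ) (ν c : Fin u → ℕ)
    (hνanti : StrictAnti ν) (hνpos : ∀ k, 0 < ν k) (hcpos : ∀ k, 0 < c k)
    (A : Matrix (Σ k : Fin u, Fin (c k) × Fin (ν k))
      (Σ k : Fin u, Fin (c k) × Fin (ν k)) K)
    (hA : A * jordanMatrixM K u c ν = jordanMatrixM K u c ν * A)
    (hAnil : IsNilpotent A) :
    ∃ G : Matrix (Σ k : Fin u, Fin (c k) × Fin (ν k))
        (Σ k : Fin u, Fin (c k) × Fin (ν k)) K,
      IsUnit G ∧ G * jordanMatrixM K u c ν = jordanMatrixM K u c ν * G ∧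
      ∀ i : Fin u, ∀ j k : Fin (c i), (j : ℕ) < (k : ℕ) →
        diagPart hνpos (G⁻¹ * A * G) i j k = 0 := by
  choose P Q hPQ hQP hlow using fun i =>
    Matrix.exists_conj_lower_triangular_of_isNilpotent _
      (isNilpotent_diagPart hνanti hνpos hA hAnil i)
  have hinv : (scalarBlocks ν P)⁻¹ = scalarBlocks ν Q :=
    Matrix.inv_eq_left_inv (scalarBlocks_mul_eq_one hQP)
  refine ⟨scalarBlocks ν P, .of_mul_eq_one _ (scalarBlocks_mul_eq_one hPQ),
    scalarBlocks_commute P, fun i j k hjk => ?_⟩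
  have hQA : Commute (scalarBlocks ν Q * A) (jordanMatrixM K u c ν) :=
    Commute.mul_left (scalarBlocks_commute Q) hA
  rw [hinv, diagPart_mul hνanti hνpos hQA (scalarBlocks_commute P),
    diagPart_mul hνanti hνpos (scalarBlocks_commute Q) hA, diagPart_scalarBlocks,
    diagPart_scalarBlocks]
  exact hlow i j k hjk
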